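/- Let 1<r≤2 and σ>1/r. Then there is a constant C (depending only on r and σ) such that for all measurable φ, ψ : ℝ² → [0,∞], ‖⟨ξ⟩^σ W(τ,ξ)‖_{L^{r'}(ℝ×ℝ², dτ dξ)} ≤ C ‖⟨η⟩^σ φ(η)‖_{L^{r'}(ℝ²)} ‖⟨η⟩^σ ψ(η)‖_{L^{r'}(ℝ²)}, where for τ > |ξ| > 0, W(τ,ξ) = ∫_{E(τ,ξ)} (|η∧(ξ−η)| / (|η||ξ−η|)) φ(η) ψ(ξ−η) |∇P₊(η)|^{−1} dH¹(η), the integral being over the ellipse E(τ,ξ) = {η ∈ ℝ² : |η| + |ξ−η| = τ} with respect to one-dimensional Hausdorff measure H¹, with ∇P₊(η) = η/|η| + (η−ξ)/|η−ξ|, and W(τ,ξ) = 0 when ξ = 0 or τ ≤ |ξ|. (This is the bilinear estimate ‖q₁₂(u₊,v₊)‖_{X^r_{σ,0}} ≲ ‖u₀‖_{Ĥ^r_σ}‖v₀‖_{Ĥ^r_σ} for free waves u₊ = e^{itD}u₀, v₊ = e^{itD}v₀ with |û₀| = φ, |v̂₀| = ψ, where q₁₂ has symbol η∧ζ/(|η||ζ|),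 the normalized symbol of the null form Q₁₂; the elliptic (++) interaction case.) -/

import Mathlib

open MeasureTheory ENNReal NNReal Classical

/-- The planar wedge product `η ∧ ζ = η₁ζ₂ − η₂ζ₁`. -/
noncomputable def wedge (η ζ : EuclideanSpace ℝ (Fin 2)) : ℝ :=
  η 0 * ζ 1 - η 1 * ζ 0

/-- The (real) gradient of `P₊(η) = |η| + |ξ − η|`, namely `η/|η| + (η−ξ)/|η−ξ|`. -/
noncomputable def gradPplus (ξ η : EuclideanSpace ℝ (Fin 2)) : EuclideanSpace ℝ (Fin 2) :=
  ‖η‖⁻¹ • η + ‖η - ξ‖⁻¹ • (η - ξ)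

/-- The weighted surface integral `W(τ, ξ)` over the ellipse `{η : |η| + |ξ−η| = τ}`
(the space-time Fourier transform of `q₁₂(u₊, v₊)` in the elliptic case), defined to
vanish when `ξ = 0` or `τ ≤ |ξ|`. -/
noncomputable def Wplus (φ ψ : EuclideanSpace ℝ (Fin 2) → ℝ≥0∞) (τ : ℝ)
    (ξ : EuclideanSpace ℝ (Fin 2)) : ℝ≥0∞ :=
  if ξ ≠ 0 ∧ ‖ξ‖ < τ then
    ∫⁻ η in {η : EuclideanSpace ℝ (Fin 2) | ‖η‖ + ‖ξ - η‖ = τ},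
      ENNReal.ofReal (|wedge η (ξ - η)| / (‖η‖ * ‖ξ - η‖)) * φ η * ψ (ξ - η) *
        ENNReal.ofReal ‖gradPplus ξ η‖⁻¹ ∂(μH[1])
  else 0

open Set
open scoped Real

/-- The integral of `f` over a parametrized curve with respect to `H¹` is at most the integral
of `f ∘ γ` against any bound `g` for the speed of `γ`. -/
theorem setLIntegral_hausdorffMeasure_image_le {X : Type*} [NormedAddCommGroup X]
    [NormedSpace ℝ X] [MeasurableSpace X] [BorelSpace X] {γ γ' : ℝ → X} {g : ℝ → ℝ}
    (hγ : ∀ t, HasDerivAt γ (γ' t) t) (hg : Continuous g) (hpos : ∀ t, 0 < g t)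
    (hbound : ∀ t, ‖γ' t‖ ≤ g t) {I : Set ℝ} (hI : MeasurableSet I) {f : X → ℝ≥0∞}
    (hf : Measurable f) :
    ∫⁻ x in γ '' I, f x ∂(μH[1]) ≤ ∫⁻ t in I, ENNReal.ofReal (g t) * f (γ t) := by
  set s : ℝ → ℝ := fun t => ∫ u in (0 : ℝ)..t, g u with hs
  have hs' : ∀ t, HasDerivAt s (g t) t := fun t => hg.integral_hasStrictDerivAt 0 t |>.hasDerivAt
  have hmono : StrictMono s := strictMono_of_deriv_pos fun t => by
    rw [(hs' t).deriv]; exact hpos t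
  have hdist : ∀ a b, a ≤ b → ‖γ b - γ a‖ ≤ s b - s a := fun a b hab =>
    image_norm_le_of_norm_deriv_right_le_deriv_boundary (f := fun t => γ t - γ a)
      (B := fun t => s t - s a) (f' := γ') (B' := g)
      (fun t _ => ((hγ t).sub_const _).continuousAt.continuousWithinAt)
      (fun t _ => ((hγ t).sub_const _).hasDerivWithinAt) (by simp)
      (fun t => (hs' t).sub_const _) (fun t _ => hbound t) ⟨hab, le_rfl⟩
  have hγc : Continuous γ := continuous_iff_continuousAt.2 fun t => (hγ t).continuousAt
  have hlen : ∀ A : Set ℝ, MeasurableSet A →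
      μH[1] (γ '' A) ≤ ∫⁻ t in A, ENNReal.ofReal (g t) := by
    intro A hA
    have hlip : LipschitzOnWith 1 (fun u => γ (Function.invFun s u)) (s '' A) := by
      refine LipschitzOnWith.of_dist_le_mul ?_
      rintro _ ⟨a, -, rfl⟩ _ ⟨b, -, rfl⟩
      simp only [Function.leftInverse_invFun hmono.injective _, NNReal.coe_one, one_mul]
      rcases le_total a b with h | h
      · rw [dist_comm, dist_comm (s a), dist_eq_norm, Real.dist_eq]
        exact (hdist a b h).trans (le_abs_self _)
      · rw [dist_eq_norm, Real.dist_eq]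
        exact (hdist b a h).trans (le_abs_self _)
    have himg : γ '' A = (fun u => γ (Function.invFun s u)) '' (s '' A) := by
      rw [image_image]
      simp only [Function.leftInverse_invFun hmono.injective _]
    rw [himg, lintegral_deriv_eq_volume_image_of_monotoneOn hA
      (fun t _ => (hs' t).hasDerivWithinAt) (hmono.monotone.monotoneOn _)]
    simpa [hausdorffMeasure_real] using hlip.hausdorffMeasure_image_le zero_le_one
  have hle : (μH[1] : Measure X).restrict (γ '' I) ≤
      ((volume.restrict I).withDensity fun t => ENNReal.ofReal (g t)).map γ := by
    refine Measure.le_iff.2 fun A hA => ?_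
    have hA' := hγc.measurable hA
    rw [Measure.restrict_apply hA, Measure.map_apply hγc.measurable hA, withDensity_apply _ hA',
      Measure.restrict_restrict hA', inter_comm A, image_inter_preimage γ I A |>.symm, inter_comm I]
    exact hlen _ (hA'.inter hI)
  calc _ ≤ ∫⁻ x, f x ∂(((volume.restrict I).withDensity
        fun t => ENNReal.ofReal (g t)).map γ) := lintegral_mono' hle le_rfl
    _ = _ := by
      rw [lintegral_map hf hγc.measurable]
      exact lintegral_withDensity_eq_lintegral_mul _ (by fun_prop) (hf.comp hγc.measurable)

theorem lintegral_add_cos_substitution_le (τ n : ℝ) (hn : n ≠ 0) (hnτ : |n| < τ) (h : ℝ → ℝ≥0∞) :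
    ∫⁻ t in Ioc (-π) π, ENNReal.ofReal (|n| * |Real.sin t| / 2) * h ((τ + n * Real.cos t) / 2)
      ≤ 2 * ∫⁻ x in Ioi 0, h x := by
  have key : ∀ s : Set ℝ, MeasurableSet s → InjOn Real.cos s →
      ∫⁻ t in s, ENNReal.ofReal (|n| * |Real.sin t| / 2) * h ((τ + n * Real.cos t) / 2)
        ≤ ∫⁻ x in Ioi 0, h x := by
    intro s hs hinj
    have hd : ∀ t ∈ s, HasDerivWithinAt (fun t => (τ + n * Real.cos t) / 2)
        (n * (-Real.sin t) / 2) s t := fun t _ =>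
      ((((Real.hasDerivAt_cos t).const_mul n).const_add τ).div_const 2).hasDerivWithinAt
    have hi : InjOn (fun t => (τ + n * Real.cos t) / 2) s := by
      intro a ha b hb hab
      refine hinj ha hb (mul_left_cancel₀ hn ?_)
      simp only at hab
      linarith
    have := lintegral_image_eq_lintegral_abs_deriv_mul hs hd hi h
    have habs : ∀ t, |n * (-Real.sin t) / 2| = |n| * |Real.sin t| / 2 := fun t => by
      simp [abs_mul, abs_div]
    simp only [habs] at this
    rw [← this]
    refine lintegral_mono_set ?_
    rintro _ ⟨t, -, rfl⟩
    have h1 : |n * Real.cos t| ≤ |n| := by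
      rw [abs_mul]; exact mul_le_of_le_one_right (abs_nonneg _) (Real.abs_cos_le_one t)
    have := (abs_le.1 h1).1
    simp only [mem_Ioi]
    linarith
  have hunion : Ioc (-π) π = Ioc (-π) 0 ∪ Ioc 0 π :=
    (Ioc_union_Ioc_eq_Ioc (by linarith [Real.pi_pos]) Real.pi_pos.le).symm
  rw [hunion, two_mul]
  refine (lintegral_union_le _ _ _).trans (add_le_add (key _ measurableSet_Ioc ?_)
    (key _ measurableSet_Ioc (Real.injOn_cos.mono Ioc_subset_Icc_self)))
  intro a ha b hb hab
  rw [← Real.cos_neg a, ← Real.cos_neg b] at hab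
  exact neg_injective (Real.injOn_cos ⟨by linarith [ha.2], by linarith [ha.1]⟩
    ⟨by linarith [hb.2], by linarith [hb.1]⟩ hab)

theorem lintegral_one_add_rpow_neg_lt_top {s : ℝ} (hs : 1 < s) :
    ∫⁻ x in Ioi (0 : ℝ), ENNReal.ofReal ((1 + x) ^ (-s)) < ∞ := by
  have h := integrableOn_add_rpow_Ioi_of_lt (a := -s) (c := 0) (m := 1) (by linarith) (by norm_num)
  simp only [add_comm _ (1 : ℝ)] at h
  exact (hasFiniteIntegral_iff_ofReal ((ae_restrict_mem measurableSet_Ioi).mono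
    fun x hx => Real.rpow_nonneg (by linarith [mem_Ioi.1 hx]) _)).1 h.2

/-- The point with parameter `θ` on the ellipse `{η : |η| + |ξ − η| = τ}`, where
`ξ = (n c, n s)` with `n > 0` and `c² + s² = 1`. -/
noncomputable def ellipsePoint (c s n τ θ : ℝ) : EuclideanSpace ℝ (Fin 2) :=
  !₂[n * c / 2 + (τ * Real.cos θ * c - √(τ ^ 2 - n ^ 2) * Real.sin θ * s) / 2,
    n * s / 2 + (τ * Real.cos θ * s + √(τ ^ 2 - n ^ 2) * Real.sin θ * c) / 2]

section Ellipse

variable {c s n τ : ℝ}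

theorem sqrt_pos_of_focal_lt (hn : 0 < n) (hτ : n < τ) : 0 < √(τ ^ 2 - n ^ 2) :=
  Real.sqrt_pos.2 (by nlinarith)

theorem sq_sqrt_of_focal_lt (hn : 0 < n) (hτ : n < τ) :
    √(τ ^ 2 - n ^ 2) ^ 2 = τ ^ 2 - n ^ 2 :=
  Real.sq_sqrt (by nlinarith)

theorem abs_mul_cos_lt (hn : 0 < n) (hτ : n < τ) (θ : ℝ) : |n * Real.cos θ| < τ := by
  rw [abs_mul, abs_of_pos hn]
  exact (mul_le_of_le_one_right hn.le (Real.abs_cos_le_one θ)).trans_lt hτ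

theorem focal_add_pos (hn : 0 < n) (hτ : n < τ) (θ : ℝ) : 0 < (τ + n * Real.cos θ) / 2 := by
  linarith [(abs_lt.1 (abs_mul_cos_lt hn hτ θ)).1]

theorem focal_sub_pos (hn : 0 < n) (hτ : n < τ) (θ : ℝ) : 0 < (τ - n * Real.cos θ) / 2 := by
  linarith [(abs_lt.1 (abs_mul_cos_lt hn hτ θ)).2]

theorem norm_eq_of_sq_add_sq {v : EuclideanSpace ℝ (Fin 2)} {a : ℝ} (ha : 0 ≤ a)
    (h : v 0 ^ 2 + v 1 ^ 2 = a ^ 2) : ‖v‖ = a := by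
  rw [EuclideanSpace.norm_eq, Fin.sum_univ_two]
  simp only [Real.norm_eq_abs, sq_abs]
  rw [h, Real.sqrt_sq ha]

theorem norm_ellipsePoint (hcs : c ^ 2 + s ^ 2 = 1) (hn : 0 < n) (hτ : n < τ) (θ : ℝ) :
    ‖ellipsePoint c s n τ θ‖ = (τ + n * Real.cos θ) / 2 := by
  refine norm_eq_of_sq_add_sq (focal_add_pos hn hτ θ).le ?_
  have hm := sq_sqrt_of_focal_lt hn hτ
  have ht := Real.sin_sq_add_cos_sq θ
  simp only [ellipsePoint, Matrix.cons_val_zero, Matrix.cons_val_one]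
  generalize √(τ ^ 2 - n ^ 2) = m at *
  linear_combination ((n + τ * Real.cos θ) ^ 2 + m ^ 2 * Real.sin θ ^ 2) / 4 * hcs
    + Real.sin θ ^ 2 / 4 * hm + (τ ^ 2 - n ^ 2) / 4 * ht

theorem norm_sub_ellipsePoint (hcs : c ^ 2 + s ^ 2 = 1) (hn : 0 < n) (hτ : n < τ) (θ : ℝ) :
    ‖!₂[n * c, n * s] - ellipsePoint c s n τ θ‖ = (τ - n * Real.cos θ) / 2 := by
  refine norm_eq_of_sq_add_sq (focal_sub_pos hn hτ θ).le ?_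
  have hm := sq_sqrt_of_focal_lt hn hτ
  have ht := Real.sin_sq_add_cos_sq θ
  simp only [ellipsePoint, PiLp.sub_apply, Matrix.cons_val_zero,
    Matrix.cons_val_one]
  generalize √(τ ^ 2 - n ^ 2) = m at *
  linear_combination ((n - τ * Real.cos θ) ^ 2 + m ^ 2 * Real.sin θ ^ 2) / 4 * hcs
    + Real.sin θ ^ 2 / 4 * hm + (τ ^ 2 - n ^ 2) / 4 * ht

theorem abs_wedge_ellipsePoint (hcs : c ^ 2 + s ^ 2 = 1) (hn : 0 < n) (θ : ℝ) :
    |wedge (ellipsePoint c s n τ θ) (!₂[n * c, n * s] - ellipsePoint c s n τ θ)| =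
      n * √(τ ^ 2 - n ^ 2) * |Real.sin θ| / 2 := by
  have h : wedge (ellipsePoint c s n τ θ) (!₂[n * c, n * s] - ellipsePoint c s n τ θ) =
      -(n * √(τ ^ 2 - n ^ 2) * Real.sin θ / 2) := by
    simp only [wedge, ellipsePoint, PiLp.sub_apply, Matrix.cons_val_zero,
      Matrix.cons_val_one]
    linear_combination -(n * √(τ ^ 2 - n ^ 2) * Real.sin θ / 2) * hcs
  rw [h, abs_neg, abs_div, abs_mul, abs_mul, abs_of_pos hn, abs_of_nonneg (Real.sqrt_nonneg _),
    abs_two]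

theorem norm_gradPplus_ellipsePoint (hcs : c ^ 2 + s ^ 2 = 1) (hn : 0 < n) (hτ : n < τ) (θ : ℝ) :
    ‖gradPplus !₂[n * c, n * s] (ellipsePoint c s n τ θ)‖ =
      √(τ ^ 2 - n ^ 2) / √((τ + n * Real.cos θ) / 2 * ((τ - n * Real.cos θ) / 2)) := by
  have hρ := focal_add_pos hn hτ θ
  have hρ' := focal_sub_pos hn hτ θ
  refine norm_eq_of_sq_add_sq (by positivity) ?_
  have hm := sq_sqrt_of_focal_lt hn hτ
  have ht := Real.sin_sq_add_cos_sq θ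
  rw [div_pow, Real.sq_sqrt (mul_pos hρ hρ').le]
  simp only [gradPplus, norm_sub_rev (ellipsePoint c s n τ θ), norm_ellipsePoint hcs hn hτ,
    norm_sub_ellipsePoint hcs hn hτ]
  simp only [ellipsePoint, PiLp.sub_apply, PiLp.add_apply, PiLp.smul_apply, smul_eq_mul,
    Matrix.cons_val_zero, Matrix.cons_val_one]
  generalize √(τ ^ 2 - n ^ 2) = m at *
  obtain ⟨ρ, hρe⟩ : ∃ ρ, ρ = (τ + n * Real.cos θ) / 2 := ⟨_, rfl⟩
  obtain ⟨ρ', hρe'⟩ : ∃ ρ', ρ' = (τ - n * Real.cos θ) / 2 := ⟨_, rfl⟩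
  rw [← hρe] at hρ ⊢
  rw [← hρe'] at hρ' ⊢
  have e0 : ρ⁻¹ * (n * c / 2 + (τ * Real.cos θ * c - m * Real.sin θ * s) / 2) +
      ρ'⁻¹ * (n * c / 2 + (τ * Real.cos θ * c - m * Real.sin θ * s) / 2 - n * c) =
      (m ^ 2 * Real.cos θ * c - τ * m * Real.sin θ * s) / (2 * (ρ * ρ')) := by
    field_simp
    rw [hρe, hρe']
    linear_combination -(Real.cos θ * c) * hm
  have e1 : ρ⁻¹ * (n * s / 2 + (τ * Real.cos θ * s + m * Real.sin θ * c) / 2) +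
      ρ'⁻¹ * (n * s / 2 + (τ * Real.cos θ * s + m * Real.sin θ * c) / 2 - n * s) =
      (m ^ 2 * Real.cos θ * s + τ * m * Real.sin θ * c) / (2 * (ρ * ρ')) := by
    field_simp
    rw [hρe, hρe']
    linear_combination -(Real.cos θ * s) * hm
  rw [e0, e1]
  field_simp
  rw [hρe, hρe']
  linear_combination m ^ 2 * (m ^ 2 * Real.cos θ ^ 2 + τ ^ 2 * Real.sin θ ^ 2) * hcs +
    m ^ 2 * Real.cos θ ^ 2 * hm + m ^ 2 * τ ^ 2 * ht

theorem hasDerivAt_ellipsePoint (θ : ℝ) :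
    HasDerivAt (ellipsePoint c s n τ)
      (-Real.sin θ • !₂[τ * c / 2, τ * s / 2] +
        Real.cos θ • !₂[-(√(τ ^ 2 - n ^ 2) * s / 2), √(τ ^ 2 - n ^ 2) * c / 2]) θ := by
  have h : ellipsePoint c s n τ = fun t => !₂[n * c / 2, n * s / 2] +
      (Real.cos t • !₂[τ * c / 2, τ * s / 2] +
        Real.sin t • !₂[-(√(τ ^ 2 - n ^ 2) * s / 2), √(τ ^ 2 - n ^ 2) * c / 2]) := by
    funext t
    ext i
    fin_cases i <;> simp [ellipsePoint] <;> ring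
  rw [h]
  exact (((Real.hasDerivAt_cos θ).smul_const _).add
    ((Real.hasDerivAt_sin θ).smul_const _)).const_add _

theorem norm_deriv_ellipsePoint (hcs : c ^ 2 + s ^ 2 = 1) (hn : 0 < n) (hτ : n < τ) (θ : ℝ) :
    ‖-Real.sin θ • !₂[τ * c / 2, τ * s / 2] +
        Real.cos θ • !₂[-(√(τ ^ 2 - n ^ 2) * s / 2), √(τ ^ 2 - n ^ 2) * c / 2]‖ =
      √((τ + n * Real.cos θ) / 2 * ((τ - n * Real.cos θ) / 2)) := by
  refine norm_eq_of_sq_add_sq (Real.sqrt_nonneg _) ?_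
  have hm := sq_sqrt_of_focal_lt hn hτ
  have ht := Real.sin_sq_add_cos_sq θ
  rw [Real.sq_sqrt (mul_pos (focal_add_pos hn hτ θ) (focal_sub_pos hn hτ θ)).le]
  simp only [PiLp.add_apply, PiLp.smul_apply, smul_eq_mul,
    Matrix.cons_val_zero, Matrix.cons_val_one]
  generalize √(τ ^ 2 - n ^ 2) = m at *
  linear_combination (τ ^ 2 * Real.sin θ ^ 2 + m ^ 2 * Real.cos θ ^ 2) / 4 * hcs
    + Real.cos θ ^ 2 / 4 * hm + τ ^ 2 / 4 * ht

theorem mem_image_ellipsePoint (hcs : c ^ 2 + s ^ 2 = 1) (hn : 0 < n) (hτ : n < τ)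
    {η : EuclideanSpace ℝ (Fin 2)} (hη : ‖η‖ + ‖!₂[n * c, n * s] - η‖ = τ) :
    η ∈ ellipsePoint c s n τ '' Ioc (-π) π := by
  have hm := sq_sqrt_of_focal_lt hn hτ
  have hm0 := sqrt_pos_of_focal_lt hn hτ
  have hτ0 : 0 < τ := hn.trans hτ
  have h1 : ‖η‖ ^ 2 = η 0 ^ 2 + η 1 ^ 2 := by
    simp [EuclideanSpace.norm_sq_eq, Fin.sum_univ_two]
  have h2 : ‖!₂[n * c, n * s] - η‖ ^ 2 = (n * c - η 0) ^ 2 + (n * s - η 1) ^ 2 := by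
    simp [EuclideanSpace.norm_sq_eq, Fin.sum_univ_two]
  rw [show ‖!₂[n * c, n * s] - η‖ = τ - ‖η‖ by linarith] at h2
  obtain ⟨m, hme⟩ : ∃ m, m = √(τ ^ 2 - n ^ 2) := ⟨_, rfl⟩
  rw [← hme] at hm hm0
  obtain ⟨u, hu⟩ : ∃ u, u = η 0 * c + η 1 * s := ⟨_, rfl⟩
  obtain ⟨v, hv⟩ : ∃ v, v = η 1 * c - η 0 * s := ⟨_, rfl⟩
  have huv : u ^ 2 + v ^ 2 = ‖η‖ ^ 2 := by
    rw [h1, hu, hv]; linear_combination (η 0 ^ 2 + η 1 ^ 2) * hcs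
  have hlin : 2 * τ * ‖η‖ = m ^ 2 + 2 * n * u := by
    rw [hm, hu]; linear_combination h1 - h2 - n ^ 2 * hcs
  have hell : ((2 * u - n) / τ) ^ 2 + (2 * v / m) ^ 2 = 1 := by
    field_simp
    have h4 : 4 * τ ^ 2 * (u ^ 2 + v ^ 2) = (m ^ 2 + 2 * n * u) ^ 2 := by
      rw [huv, ← hlin]; ring
    linear_combination h4 + (4 * u ^ 2 + m ^ 2) * hm
  have hz : ‖(⟨(2 * u - n) / τ, 2 * v / m⟩ : ℂ)‖ = 1 := by
    rw [← sq_eq_sq₀ (norm_nonneg _) zero_le_one, Complex.sq_norm, Complex.normSq_mk]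
    linear_combination hell
  have hz0 : (⟨(2 * u - n) / τ, 2 * v / m⟩ : ℂ) ≠ 0 := norm_ne_zero_iff.1 (by simp [hz])
  refine ⟨_, Complex.arg_mem_Ioc ⟨(2 * u - n) / τ, 2 * v / m⟩, ?_⟩
  have hp0 : n * c / 2 + (τ * ((2 * u - n) / τ) * c - m * (2 * v / m) * s) / 2 = η 0 := by
    field_simp
    rw [hu, hv]
    linear_combination 2 * η 0 * hcs
  have hp1 : n * s / 2 + (τ * ((2 * u - n) / τ) * s + m * (2 * v / m) * c) / 2 = η 1 := by
    field_simp
    rw [hu, hv]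
    linear_combination 2 * η 1 * hcs
  simp only [ellipsePoint, ← hme, Complex.cos_arg hz0, Complex.sin_arg, hz, div_one]
  ext i
  fin_cases i
  · exact hp0
  · exact hp1

end Ellipse

section EllipticCoordinates

variable {c s n : ℝ}

theorem ellipsePoint_injOn (hcs : c ^ 2 + s ^ 2 = 1) (hn : 0 < n) :
    InjOn (fun p : ℝ × ℝ => ellipsePoint c s n p.1 p.2) (Ioi n ×ˢ Ioc (-π) π) := by
  rintro ⟨τ, θ⟩ ⟨hτ, hθ⟩ ⟨τ', θ'⟩ ⟨hτ', hθ'⟩ h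
  simp only [mem_Ioi] at hτ hτ' hθ hθ' h
  have h1 := norm_ellipsePoint hcs hn hτ θ
  have h2 := norm_sub_ellipsePoint hcs hn hτ θ
  rw [h] at h1 h2
  rw [norm_ellipsePoint hcs hn hτ' θ'] at h1
  rw [norm_sub_ellipsePoint hcs hn hτ' θ'] at h2
  have hττ : τ' = τ := by linarith
  subst hττ
  have hcos : Real.cos θ' = Real.cos θ := mul_left_cancel₀ hn.ne' (by linarith)
  have hm := sqrt_pos_of_focal_lt hn hτ
  have h0 := congrArg (fun v : EuclideanSpace ℝ (Fin 2) => v 1 * c - v 0 * s) h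
  simp only [ellipsePoint, Matrix.cons_val_zero, Matrix.cons_val_one, hcos] at h0
  have hsin : Real.sin θ = Real.sin θ' := by
    refine mul_left_cancel₀ hm.ne' ?_
    linear_combination 2 * h0 - (√(τ' ^ 2 - n ^ 2) * (Real.sin θ - Real.sin θ')) * hcs
  have e1 := Complex.arg_cos_add_sin_mul_I hθ
  have e2 := Complex.arg_cos_add_sin_mul_I hθ'
  rw [← Complex.ofReal_cos, ← Complex.ofReal_sin] at e1 e2
  rw [hcos, ← hsin, e1] at e2
  rw [e2]

/-- The change of variables `η = ellipsePoint c s n τ θ`. -/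
theorem lintegral_ellipsePoint_le (hcs : c ^ 2 + s ^ 2 = 1) (hn : 0 < n)
    (F : EuclideanSpace ℝ (Fin 2) → ℝ≥0∞) :
    ∫⁻ p in Ioi n ×ˢ Ioc (-π) π, ENNReal.ofReal
        ((p.1 + n * Real.cos p.2) / 2 * ((p.1 - n * Real.cos p.2) / 2) / √(p.1 ^ 2 - n ^ 2)) *
          F (ellipsePoint c s n p.1 p.2) ≤ ∫⁻ η, F η := by
  set e : EuclideanSpace ℝ (Fin 2) ≃ᵐ ℝ × ℝ :=
    (MeasurableEquiv.toLp 2 (Fin 2 → ℝ)).symm.trans MeasurableEquiv.finTwoArrow with he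
  have hvol : MeasurePreserving e :=
    (volume_preserving_finTwoArrow ℝ).comp
      (EuclideanSpace.volume_preserving_symm_measurableEquiv_toLp (Fin 2))
  set Γ : ℝ × ℝ → ℝ × ℝ := fun p => e (ellipsePoint c s n p.1 p.2) with hΓ
  set Γ' : ℝ × ℝ → ℝ × ℝ →L[ℝ] ℝ × ℝ := fun p =>
    (Matrix.toLin (.finTwoProd ℝ) (.finTwoProd ℝ)
      !![Real.cos p.2 * c / 2 - p.1 / √(p.1 ^ 2 - n ^ 2) * Real.sin p.2 * s / 2,
        -(p.1 * Real.sin p.2 * c / 2) - √(p.1 ^ 2 - n ^ 2) * Real.cos p.2 * s / 2;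
        Real.cos p.2 * s / 2 + p.1 / √(p.1 ^ 2 - n ^ 2) * Real.sin p.2 * c / 2,
        -(p.1 * Real.sin p.2 * s / 2) + √(p.1 ^ 2 - n ^ 2) * Real.cos p.2 * c / 2]).toContinuousLinearMap
    with hΓ'
  have hmeas : MeasurableSet (Ioi n ×ˢ Ioc (-π) π) := measurableSet_Ioi.prod measurableSet_Ioc
  have hder : ∀ p ∈ Ioi n ×ˢ Ioc (-π) π,
      HasFDerivWithinAt Γ (Γ' p) (Ioi n ×ˢ Ioc (-π) π) p := by
    rintro ⟨τ, θ⟩ ⟨hτ, -⟩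
    simp only [mem_Ioi] at hτ
    have hm := sqrt_pos_of_focal_lt hn hτ
    have hM : HasFDerivAt (fun p : ℝ × ℝ => √(p.1 ^ 2 - n ^ 2))
        ((τ / √(τ ^ 2 - n ^ 2)) • ContinuousLinearMap.fst ℝ ℝ ℝ) (τ, θ) := by
      have : HasDerivAt (fun t : ℝ => √(t ^ 2 - n ^ 2)) (τ / √(τ ^ 2 - n ^ 2)) τ := by
        refine (((hasDerivAt_pow 2 τ).sub_const (n ^ 2)).sqrt
          (Real.sqrt_ne_zero'.1 hm.ne').ne').congr_deriv ?_
        field_simp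
        simp
      exact HasDerivAt.comp_hasFDerivAt (h₂ := fun t : ℝ => √(t ^ 2 - n ^ 2)) (τ, θ) this
        hasFDerivAt_fst
    have hC : HasFDerivAt (fun p : ℝ × ℝ => Real.cos p.2)
        (-Real.sin θ • ContinuousLinearMap.snd ℝ ℝ ℝ) (τ, θ) :=
      HasDerivAt.comp_hasFDerivAt (h₂ := Real.cos) (τ, θ) (Real.hasDerivAt_cos θ) hasFDerivAt_snd
    have hS : HasFDerivAt (fun p : ℝ × ℝ => Real.sin p.2)
        (Real.cos θ • ContinuousLinearMap.snd ℝ ℝ ℝ) (τ, θ) :=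
      HasDerivAt.comp_hasFDerivAt (h₂ := Real.sin) (τ, θ) (Real.hasDerivAt_sin θ) hasFDerivAt_snd
    have hT : HasFDerivAt (fun p : ℝ × ℝ => p.1) (ContinuousLinearMap.fst ℝ ℝ ℝ) (τ, θ) :=
      hasFDerivAt_fst
    have h0 := ((((hT.mul hC).mul_const c).sub ((hM.mul hS).mul_const s)).mul_const
      (2⁻¹ : ℝ)).const_add (n * c / 2)
    have h1 := ((((hT.mul hC).mul_const s).add ((hM.mul hS).mul_const c)).mul_const
      (2⁻¹ : ℝ)).const_add (n * s / 2)
    refine ((h0.prodMk h1).congr_fderiv ?_).hasFDerivWithinAt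
    rw [hΓ']
    simp only [Matrix.toLin_finTwoProd_toContinuousLinearMap]
    ext <;> simp <;> ring
  have hinj : InjOn Γ (Ioi n ×ˢ Ioc (-π) π) :=
    e.injective.comp_injOn (ellipsePoint_injOn hcs hn)
  have hdet : ∀ p ∈ Ioi n ×ˢ Ioc (-π) π, |(Γ' p).det| =
      (p.1 + n * Real.cos p.2) / 2 * ((p.1 - n * Real.cos p.2) / 2) / √(p.1 ^ 2 - n ^ 2) := by
    rintro ⟨τ, θ⟩ ⟨hτ, -⟩
    simp only [mem_Ioi] at hτ
    have hm := sqrt_pos_of_focal_lt hn hτ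
    have hsq := sq_sqrt_of_focal_lt hn hτ
    have ht := Real.sin_sq_add_cos_sq θ
    have hpos := mul_pos (focal_add_pos hn hτ θ) (focal_sub_pos hn hτ θ)
    have : (Γ' (τ, θ)).det = (τ + n * Real.cos θ) / 2 * ((τ - n * Real.cos θ) / 2) /
        √(τ ^ 2 - n ^ 2) := by
      simp only [hΓ', LinearMap.det_toContinuousLinearMap, LinearMap.det_toLin,
        Matrix.det_fin_two_of]
      generalize √(τ ^ 2 - n ^ 2) = m at *
      field_simp
      linear_combination (m ^ 2 * Real.cos θ ^ 2 + τ ^ 2 * Real.sin θ ^ 2) * hcs +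
        Real.cos θ ^ 2 * hsq + τ ^ 2 * ht
    rw [this, abs_of_pos (div_pos hpos hm)]
  calc _ = ∫⁻ p in Ioi n ×ˢ Ioc (-π) π, ENNReal.ofReal |(Γ' p).det| * F (e.symm (Γ p)) := by
        refine setLIntegral_congr_fun hmeas fun p hp => ?_
        simp only [hdet p hp, hΓ, MeasurableEquiv.symm_apply_apply]
    _ = ∫⁻ x in Γ '' (Ioi n ×ˢ Ioc (-π) π), F (e.symm x) :=
      (lintegral_image_eq_lintegral_abs_det_fderiv_mul volume hmeas hder hinj
        fun x => F (e.symm x)).symm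
    _ ≤ ∫⁻ x, F (e.symm x) := setLIntegral_le_lintegral _ _
    _ = ∫⁻ η, F η := hvol.symm.lintegral_map_equiv F e.symm |>.symm

end EllipticCoordinates

section PointwiseBound

variable {c s n τ : ℝ}

theorem measurable_ellipsePoint :
    Measurable fun p : ℝ × ℝ => ellipsePoint c s n p.1 p.2 := by
  have : Continuous fun p : ℝ × ℝ => ellipsePoint c s n p.1 p.2 := by
    refine (PiLp.continuous_toLp 2 _).comp (continuous_pi fun i => ?_)
    fin_cases i <;> simp <;> fun_prop
  exact this.measurable

theorem norm_toLp_mul_eq (hcs : c ^ 2 + s ^ 2 = 1) (hn : 0 < n) :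
    ‖(!₂[n * c, n * s] : EuclideanSpace ℝ (Fin 2))‖ = n := by
  refine norm_eq_of_sq_add_sq hn.le ?_
  simp only [Matrix.cons_val_zero, Matrix.cons_val_one]
  linear_combination n ^ 2 * hcs

theorem Wplus_le_lintegral_angle (hcs : c ^ 2 + s ^ 2 = 1) (hn : 0 < n) (hτ : n < τ)
    {φ ψ : EuclideanSpace ℝ (Fin 2) → ℝ≥0∞} (hφ : Measurable φ) (hψ : Measurable ψ) :
    Wplus φ ψ τ !₂[n * c, n * s] ≤ ∫⁻ θ in Ioc (-π) π,
      ENNReal.ofReal (n * |Real.sin θ| / 2) *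
        (φ (ellipsePoint c s n τ θ) * ψ (!₂[n * c, n * s] - ellipsePoint c s n τ θ)) := by
  set ξ : EuclideanSpace ℝ (Fin 2) := !₂[n * c, n * s] with hξ
  have hnorm : ‖ξ‖ = n := norm_toLp_mul_eq hcs hn
  have hξ0 : ξ ≠ 0 := norm_pos_iff.1 (hnorm ▸ hn)
  rw [Wplus, if_pos ⟨hξ0, hnorm ▸ hτ⟩]
  have hmeas : Measurable fun η : EuclideanSpace ℝ (Fin 2) =>
      ENNReal.ofReal (|wedge η (ξ - η)| / (‖η‖ * ‖ξ - η‖)) * φ η * ψ (ξ - η) *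
        ENNReal.ofReal ‖gradPplus ξ η‖⁻¹ := by
    unfold wedge gradPplus
    fun_prop
  refine (lintegral_mono_set fun η hη => mem_image_ellipsePoint hcs hn hτ hη).trans ?_
  refine (setLIntegral_hausdorffMeasure_image_le hasDerivAt_ellipsePoint (by fun_prop)
    (fun θ => Real.sqrt_pos.2 (mul_pos (focal_add_pos hn hτ θ) (focal_sub_pos hn hτ θ)))
    (fun θ => (norm_deriv_ellipsePoint hcs hn hτ θ).le) measurableSet_Ioc hmeas).trans_eq ?_
  refine lintegral_congr fun θ => ?_
  have hρ := focal_add_pos hn hτ θ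
  have hρ' := focal_sub_pos hn hτ θ
  have hm := sqrt_pos_of_focal_lt hn hτ
  simp only [hξ, norm_ellipsePoint hcs hn hτ, norm_sub_ellipsePoint hcs hn hτ,
    abs_wedge_ellipsePoint hcs hn, norm_gradPplus_ellipsePoint hcs hn hτ]
  generalize (τ + n * Real.cos θ) / 2 = ρ at *
  generalize (τ - n * Real.cos θ) / 2 = ρ' at *
  generalize √(τ ^ 2 - n ^ 2) = m at *
  have hq : 0 < √(ρ * ρ') := Real.sqrt_pos.2 (mul_pos hρ hρ')
  have hqq : √(ρ * ρ') ^ 2 = ρ * ρ' := Real.sq_sqrt (mul_pos hρ hρ').le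
  have hreal : n * |Real.sin θ| / 2 =
      √(ρ * ρ') * (n * m * |Real.sin θ| / 2 / (ρ * ρ')) * (m / √(ρ * ρ'))⁻¹ := by
    generalize √(ρ * ρ') = q at hq hqq ⊢
    rw [← hqq]
    field_simp
  rw [hreal, ENNReal.ofReal_mul (by positivity), ENNReal.ofReal_mul (by positivity)]
  ring

theorem rpow_japanese_weight_le {σ r a b k : ℝ} (hσ : 0 < σ) (hr : 0 < r) (ha : 0 < a)
    (hb : 0 < b) (hk : 0 ≤ k) (hkab : k ≤ a + b) :
    ((1 + k) ^ σ * ((1 + a) ^ (-σ) * (1 + b) ^ (-σ))) ^ r ≤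
      2 ^ (σ * r) * ((1 + a) ^ (-(σ * r)) + (1 + b) ^ (-(σ * r))) := by
  have aux : ∀ a b : ℝ, 0 < a → a ≤ b → k ≤ a + b →
      ((1 + k) ^ σ * ((1 + a) ^ (-σ) * (1 + b) ^ (-σ))) ^ r ≤
        2 ^ (σ * r) * (1 + a) ^ (-(σ * r)) := by
    intro a b ha hab hkab
    have hb : 0 < b := ha.trans_le hab
    have h1 : (1 + k) ^ σ ≤ 2 ^ σ * (1 + b) ^ σ := by
      rw [← Real.mul_rpow (by norm_num) (by positivity)]
      exact Real.rpow_le_rpow (by positivity) (by linarith) hσ.le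
    have h2 : (1 + b) ^ σ * (1 + b) ^ (-σ) = 1 := by
      rw [← Real.rpow_add (by positivity)]; simp
    calc _ ≤ (2 ^ σ * (1 + b) ^ σ * ((1 + a) ^ (-σ) * (1 + b) ^ (-σ))) ^ r := by gcongr
      _ = (2 ^ σ * (1 + a) ^ (-σ)) ^ r := by
        congr 1
        linear_combination 2 ^ σ * (1 + a) ^ (-σ) * h2
      _ = _ := by
        rw [Real.mul_rpow (by positivity) (by positivity), ← Real.rpow_mul (by norm_num),
          ← Real.rpow_mul (by positivity), neg_mul]
  rcases le_total a b with h | h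
  · refine (aux a b ha h hkab).trans ?_
    gcongr
    exact le_add_of_nonneg_right (by positivity)
  · have := aux b a hb h (by linarith)
    rw [mul_comm ((1 + b) ^ (-σ))] at this
    refine this.trans ?_
    gcongr
    exact le_add_of_nonneg_left (by positivity)

theorem lintegral_angular_weight_le {σ r : ℝ} (hσ : 0 < σ) (hr : 1 ≤ r) (hn : 0 < n)
    (hτ : n < τ) :
    ∫⁻ θ in Ioc (-π) π, ENNReal.ofReal
        ((τ + n * Real.cos θ) / 2 * ((τ - n * Real.cos θ) / 2) / √(τ ^ 2 - n ^ 2)) *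
        ENNReal.ofReal (n * √(τ ^ 2 - n ^ 2) * |Real.sin θ| / 2 /
          ((τ + n * Real.cos θ) / 2 * ((τ - n * Real.cos θ) / 2)) *
          ((1 + n) ^ σ * ((1 + (τ + n * Real.cos θ) / 2) ^ (-σ) *
            (1 + (τ - n * Real.cos θ) / 2) ^ (-σ)))) ^ r ≤
      ENNReal.ofReal (2 ^ (σ * r)) *
        (4 * ∫⁻ x in Ioi (0 : ℝ), ENNReal.ofReal ((1 + x) ^ (-(σ * r)))) := by
  have hr0 : 0 < r := by linarith
  set h : ℝ → ℝ≥0∞ := fun x => ENNReal.ofReal ((1 + x) ^ (-(σ * r))) with hh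
  have hhm : Measurable h := by fun_prop
  have hpt : ∀ θ, ENNReal.ofReal
        ((τ + n * Real.cos θ) / 2 * ((τ - n * Real.cos θ) / 2) / √(τ ^ 2 - n ^ 2)) *
        ENNReal.ofReal (n * √(τ ^ 2 - n ^ 2) * |Real.sin θ| / 2 /
          ((τ + n * Real.cos θ) / 2 * ((τ - n * Real.cos θ) / 2)) *
          ((1 + n) ^ σ * ((1 + (τ + n * Real.cos θ) / 2) ^ (-σ) *
            (1 + (τ - n * Real.cos θ) / 2) ^ (-σ)))) ^ r ≤
      ENNReal.ofReal (2 ^ (σ * r)) *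
        (ENNReal.ofReal (|n| * |Real.sin θ| / 2) * h ((τ + n * Real.cos θ) / 2) +
          ENNReal.ofReal (|-n| * |Real.sin θ| / 2) * h ((τ + -n * Real.cos θ) / 2)) := by
    intro θ
    have hρ := focal_add_pos hn hτ θ
    have hρ' := focal_sub_pos hn hτ θ
    have hm := sqrt_pos_of_focal_lt hn hτ
    have hsum : n ≤ (τ + n * Real.cos θ) / 2 + (τ - n * Real.cos θ) / 2 := by linarith
    have hK : n * √(τ ^ 2 - n ^ 2) * |Real.sin θ| / 2 ≤
        (τ + n * Real.cos θ) / 2 * ((τ - n * Real.cos θ) / 2) := by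
      have e1 := sq_sqrt_of_focal_lt hn hτ
      have e2 := Real.sin_sq_add_cos_sq θ
      have e3 := sq_nonneg (√(τ ^ 2 - n ^ 2) - n * |Real.sin θ|)
      have e4 := sq_abs (Real.sin θ)
      nlinarith
    rw [neg_mul, ← sub_eq_add_neg, abs_neg, abs_of_pos hn, ← mul_add, hh]
    simp only
    generalize (τ + n * Real.cos θ) / 2 = ρ at *
    generalize (τ - n * Real.cos θ) / 2 = ρ' at *
    generalize √(τ ^ 2 - n ^ 2) = m at *
    have hw := rpow_japanese_weight_le hσ hr0 hρ hρ' hn.le hsum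
    set w := (1 + n) ^ σ * ((1 + ρ) ^ (-σ) * (1 + ρ') ^ (-σ)) with hwdef
    have hw0 : 0 ≤ w := by positivity
    have hk1 : n * m * |Real.sin θ| / 2 / (ρ * ρ') ≤ 1 := (div_le_one (by positivity)).2 hK
    have hk0 : 0 ≤ n * m * |Real.sin θ| / 2 / (ρ * ρ') := by positivity
    have hkr : (n * m * |Real.sin θ| / 2 / (ρ * ρ')) ^ r ≤ n * m * |Real.sin θ| / 2 / (ρ * ρ') := by
      simpa using Real.rpow_le_rpow_of_exponent_ge_of_imp hk0 hk1 hr (by intros; linarith)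
    rw [ENNReal.ofReal_rpow_of_nonneg (by positivity) hr0.le,
      ← ENNReal.ofReal_add (by positivity) (by positivity), ← ENNReal.ofReal_mul (by positivity),
      ← ENNReal.ofReal_mul (by positivity), ← ENNReal.ofReal_mul (by positivity)]
    refine ENNReal.ofReal_le_ofReal ?_
    rw [Real.mul_rpow hk0 hw0]
    calc ρ * ρ' / m * ((n * m * |Real.sin θ| / 2 / (ρ * ρ')) ^ r * w ^ r)
        ≤ ρ * ρ' / m * (n * m * |Real.sin θ| / 2 / (ρ * ρ') *
          (2 ^ (σ * r) * ((1 + ρ) ^ (-(σ * r)) + (1 + ρ') ^ (-(σ * r))))) := by gcongr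
      _ = _ := by field_simp
  refine (lintegral_mono hpt).trans ?_
  rw [lintegral_const_mul' _ _ ENNReal.ofReal_ne_top, lintegral_add_left (by fun_prop)]
  gcongr
  refine (add_le_add
    (lintegral_add_cos_substitution_le τ n hn.ne' (by rwa [abs_of_pos hn]) h)
    (lintegral_add_cos_substitution_le τ (-n) (neg_ne_zero.2 hn.ne')
      (by rwa [abs_neg, abs_of_pos hn]) h)).trans_eq ?_
  ring

end PointwiseBound

section FixedFrequency

variable {c s n r r' σ : ℝ}

theorem Wplus_rpow_le_lintegral_angle (hcs : c ^ 2 + s ^ 2 = 1) (hn : 0 < n) {τ : ℝ} (hτ : n < τ)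
    (hrr' : r.HolderConjugate r') (hσ : 0 < σ) {φ ψ : EuclideanSpace ℝ (Fin 2) → ℝ≥0∞}
    (hφ : Measurable φ) (hψ : Measurable ψ) :
    (ENNReal.ofReal ((1 + n) ^ σ) * Wplus φ ψ τ !₂[n * c, n * s]) ^ r' ≤
      ((ENNReal.ofReal (2 ^ (σ * r)) * (4 * ∫⁻ x in Ioi (0 : ℝ),
        ENNReal.ofReal ((1 + x) ^ (-(σ * r))))) ^ (1 / r)) ^ r' *
      ∫⁻ θ in Ioc (-π) π, ENNReal.ofReal
        ((τ + n * Real.cos θ) / 2 * ((τ - n * Real.cos θ) / 2) / √(τ ^ 2 - n ^ 2)) *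
        (ENNReal.ofReal ((1 + ‖ellipsePoint c s n τ θ‖) ^ σ) * φ (ellipsePoint c s n τ θ) *
          (ENNReal.ofReal ((1 + ‖!₂[n * c, n * s] - ellipsePoint c s n τ θ‖) ^ σ) *
            ψ (!₂[n * c, n * s] - ellipsePoint c s n τ θ))) ^ r' := by
  set A := ENNReal.ofReal (2 ^ (σ * r)) * (4 * ∫⁻ x in Ioi (0 : ℝ),
        ENNReal.ofReal ((1 + x) ^ (-(σ * r)))) with hA
  set J : ℝ → ℝ := fun θ =>
    (τ + n * Real.cos θ) / 2 * ((τ - n * Real.cos θ) / 2) / √(τ ^ 2 - n ^ 2) with hJ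
  set a : ℝ → ℝ≥0∞ := fun θ => ENNReal.ofReal (n * √(τ ^ 2 - n ^ 2) * |Real.sin θ| / 2 /
          ((τ + n * Real.cos θ) / 2 * ((τ - n * Real.cos θ) / 2)) *
          ((1 + n) ^ σ * ((1 + (τ + n * Real.cos θ) / 2) ^ (-σ) *
            (1 + (τ - n * Real.cos θ) / 2) ^ (-σ)))) with ha
  set G : ℝ → ℝ≥0∞ := fun θ =>
    ENNReal.ofReal ((1 + ‖ellipsePoint c s n τ θ‖) ^ σ) * φ (ellipsePoint c s n τ θ) *
          (ENNReal.ofReal ((1 + ‖!₂[n * c, n * s] - ellipsePoint c s n τ θ‖) ^ σ) *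
            ψ (!₂[n * c, n * s] - ellipsePoint c s n τ θ)) with hG
  have hpt : Measurable (ellipsePoint c s n τ) :=
    (measurable_ellipsePoint (c := c) (s := s) (n := n)).comp measurable_prodMk_left
  have hJm : Measurable fun θ => ENNReal.ofReal (J θ) := by fun_prop
  have ham : Measurable a := by fun_prop
  have hGm : Measurable G := by fun_prop
  have hpoint : ∀ θ, ENNReal.ofReal ((1 + n) ^ σ) * (ENNReal.ofReal (n * |Real.sin θ| / 2) *
      (φ (ellipsePoint c s n τ θ) * ψ (!₂[n * c, n * s] - ellipsePoint c s n τ θ))) =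
      ENNReal.ofReal (J θ) * (a * G) θ := by
    intro θ
    have hρ := focal_add_pos hn hτ θ
    have hρ' := focal_sub_pos hn hτ θ
    have hm := sqrt_pos_of_focal_lt hn hτ
    simp only [Pi.mul_apply, hJ, ha, hG, norm_ellipsePoint hcs hn hτ,
      norm_sub_ellipsePoint hcs hn hτ]
    generalize (τ + n * Real.cos θ) / 2 = ρ at *
    generalize (τ - n * Real.cos θ) / 2 = ρ' at *
    generalize √(τ ^ 2 - n ^ 2) = m at *
    have hcancel : ∀ x : ℝ, 0 < x → (1 + x) ^ (-σ) * (1 + x) ^ σ = 1 := fun x hx => by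
      rw [← Real.rpow_add (by positivity)]; simp
    have hreal : (1 + n) ^ σ * (n * |Real.sin θ| / 2) =
        ρ * ρ' / m * (n * m * |Real.sin θ| / 2 / (ρ * ρ') *
          ((1 + n) ^ σ * ((1 + ρ) ^ (-σ) * (1 + ρ') ^ (-σ)))) * (1 + ρ) ^ σ * (1 + ρ') ^ σ := by
      calc (1 + n) ^ σ * (n * |Real.sin θ| / 2) = (1 + n) ^ σ * (n * |Real.sin θ| / 2) *
            ((1 + ρ) ^ (-σ) * (1 + ρ) ^ σ) * ((1 + ρ') ^ (-σ) * (1 + ρ') ^ σ) := by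
            rw [hcancel _ hρ, hcancel _ hρ', mul_one, mul_one]
        _ = _ := by field_simp
    rw [← mul_assoc, ← ENNReal.ofReal_mul (by positivity), hreal,
      ENNReal.ofReal_mul (by positivity), ENNReal.ofReal_mul (by positivity),
      ENNReal.ofReal_mul (by positivity)]
    ring
  have hholder := ENNReal.lintegral_mul_le_Lp_mul_Lq
    ((volume.restrict (Ioc (-π) π)).withDensity fun θ => ENNReal.ofReal (J θ)) hrr'
    ham.aemeasurable hGm.aemeasurable
  rw [lintegral_withDensity_eq_lintegral_mul _ hJm (ham.mul hGm),
    lintegral_withDensity_eq_lintegral_mul _ hJm (ham.pow_const r),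
    lintegral_withDensity_eq_lintegral_mul _ hJm (hGm.pow_const r')] at hholder
  have hW : ENNReal.ofReal ((1 + n) ^ σ) * Wplus φ ψ τ !₂[n * c, n * s] ≤
      A ^ (1 / r) * (∫⁻ θ in Ioc (-π) π, ENNReal.ofReal (J θ) * G θ ^ r') ^ (1 / r') := by
    calc _ ≤ ENNReal.ofReal ((1 + n) ^ σ) * ∫⁻ θ in Ioc (-π) π,
          ENNReal.ofReal (n * |Real.sin θ| / 2) * (φ (ellipsePoint c s n τ θ) *
            ψ (!₂[n * c, n * s] - ellipsePoint c s n τ θ)) := by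
          gcongr
          exact Wplus_le_lintegral_angle hcs hn hτ hφ hψ
      _ = ∫⁻ θ in Ioc (-π) π, ENNReal.ofReal (J θ) * (a * G) θ := by
          rw [← lintegral_const_mul' _ _ ENNReal.ofReal_ne_top]
          simp only [hpoint]
      _ ≤ _ := hholder
      _ ≤ _ := by
          refine mul_le_mul_left (ENNReal.rpow_le_rpow ?_ (one_div_nonneg.2 hrr'.nonneg)) _
          exact lintegral_angular_weight_le hσ hrr'.lt.le hn hτ
  refine (ENNReal.rpow_le_rpow hW hrr'.symm.nonneg).trans_eq ?_
  rw [ENNReal.mul_rpow_of_nonneg _ _ hrr'.symm.nonneg, ← ENNReal.rpow_mul _ (1 / r') r',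
    one_div_mul_cancel hrr'.symm.ne_zero, ENNReal.rpow_one]

theorem lintegral_Wplus_rpow_le (hrr' : r.HolderConjugate r') (hσ : 0 < σ)
    {φ ψ : EuclideanSpace ℝ (Fin 2) → ℝ≥0∞} (hφ : Measurable φ) (hψ : Measurable ψ)
    (ξ : EuclideanSpace ℝ (Fin 2)) :
    ∫⁻ τ, (ENNReal.ofReal ((1 + ‖ξ‖) ^ σ) * Wplus φ ψ τ ξ) ^ r' ≤
      ((ENNReal.ofReal (2 ^ (σ * r)) * (4 * ∫⁻ x in Ioi (0 : ℝ),
        ENNReal.ofReal ((1 + x) ^ (-(σ * r))))) ^ (1 / r)) ^ r' *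
      ∫⁻ η, (ENNReal.ofReal ((1 + ‖η‖) ^ σ) * φ η *
        (ENNReal.ofReal ((1 + ‖ξ - η‖) ^ σ) * ψ (ξ - η))) ^ r' := by
  set B := ((ENNReal.ofReal (2 ^ (σ * r)) * (4 * ∫⁻ x in Ioi (0 : ℝ),
        ENNReal.ofReal ((1 + x) ^ (-(σ * r))))) ^ (1 / r)) ^ r' with hB
  have hzero : ∀ τ, ¬(ξ ≠ 0 ∧ ‖ξ‖ < τ) →
      (ENNReal.ofReal ((1 + ‖ξ‖) ^ σ) * Wplus φ ψ τ ξ) ^ r' = 0 := fun τ h => by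
    rw [Wplus, if_neg h, mul_zero, ENNReal.zero_rpow_of_pos hrr'.symm.pos]
  rcases eq_or_ne ξ 0 with hξ | hξ
  · simp [hzero _ fun h => h.1 hξ]
  obtain ⟨n, hnξ⟩ : ∃ n, n = ‖ξ‖ := ⟨_, rfl⟩
  have hn : 0 < n := hnξ ▸ norm_pos_iff.2 hξ
  obtain ⟨c, hc⟩ : ∃ c, c = ξ 0 / n := ⟨_, rfl⟩
  obtain ⟨s, hs⟩ : ∃ s, s = ξ 1 / n := ⟨_, rfl⟩
  have hcs : c ^ 2 + s ^ 2 = 1 := by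
    have h : n ^ 2 = ξ 0 ^ 2 + ξ 1 ^ 2 := by
      simp [hnξ, EuclideanSpace.norm_sq_eq, Fin.sum_univ_two]
    rw [hc, hs]
    field_simp
    exact h.symm
  have hξe : ξ = !₂[n * c, n * s] := by
    rw [hc, hs, mul_div_cancel₀ _ hn.ne', mul_div_cancel₀ _ hn.ne']
    ext i
    fin_cases i <;> rfl
  set F : EuclideanSpace ℝ (Fin 2) → ℝ≥0∞ := fun η => (ENNReal.ofReal ((1 + ‖η‖) ^ σ) * φ η *
    (ENNReal.ofReal ((1 + ‖ξ - η‖) ^ σ) * ψ (ξ - η))) ^ r' with hF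
  have hFm : Measurable F := by fun_prop
  have hjoint : Measurable fun p : ℝ × ℝ => ENNReal.ofReal
      ((p.1 + n * Real.cos p.2) / 2 * ((p.1 - n * Real.cos p.2) / 2) / √(p.1 ^ 2 - n ^ 2)) *
        F (ellipsePoint c s n p.1 p.2) :=
    Measurable.mul (by fun_prop) (hFm.comp measurable_ellipsePoint)
  calc ∫⁻ τ, (ENNReal.ofReal ((1 + ‖ξ‖) ^ σ) * Wplus φ ψ τ ξ) ^ r'
      = ∫⁻ τ in Ioi n, (ENNReal.ofReal ((1 + ‖ξ‖) ^ σ) * Wplus φ ψ τ ξ) ^ r' := by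
        refine (setLIntegral_eq_of_support_subset fun τ hτ => ?_).symm
        by_contra h
        exact hτ (hzero τ fun h' => h (hnξ ▸ h'.2))
    _ ≤ ∫⁻ τ in Ioi n, B * ∫⁻ θ in Ioc (-π) π, ENNReal.ofReal
          ((τ + n * Real.cos θ) / 2 * ((τ - n * Real.cos θ) / 2) / √(τ ^ 2 - n ^ 2)) *
            F (ellipsePoint c s n τ θ) := by
        refine setLIntegral_mono' measurableSet_Ioi fun τ hτ => ?_
        have := Wplus_rpow_le_lintegral_angle hcs hn hτ hrr' hσ hφ hψ
        rw [← hξe] at this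
        rw [← hnξ]
        exact this
    _ = B * ∫⁻ τ in Ioi n, ∫⁻ θ in Ioc (-π) π, ENNReal.ofReal
          ((τ + n * Real.cos θ) / 2 * ((τ - n * Real.cos θ) / 2) / √(τ ^ 2 - n ^ 2)) *
            F (ellipsePoint c s n τ θ) := lintegral_const_mul _ hjoint.lintegral_prod_right'
    _ = B * ∫⁻ p in Ioi n ×ˢ Ioc (-π) π, ENNReal.ofReal
          ((p.1 + n * Real.cos p.2) / 2 * ((p.1 - n * Real.cos p.2) / 2) / √(p.1 ^ 2 - n ^ 2)) *
            F (ellipsePoint c s n p.1 p.2) := by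
        rw [Measure.volume_eq_prod, ← Measure.prod_restrict, lintegral_prod _ hjoint.aemeasurable]
    _ ≤ B * ∫⁻ η, F η := by
        gcongr
        exact lintegral_ellipsePoint_le hcs hn F

end FixedFrequency

theorem lintegral_lintegral_mul_sub_eq {G : Type*} [AddCommGroup G] [MeasurableSpace G]
    [MeasurableAdd₂ G] [MeasurableNeg G] (μ : Measure G) [SFinite μ] [μ.IsAddRightInvariant]
    {f g : G → ℝ≥0∞} (hf : Measurable f) (hg : Measurable g) :
    ∫⁻ x, ∫⁻ y, f y * g (x - y) ∂μ ∂μ = (∫⁻ y, f y ∂μ) * ∫⁻ x, g x ∂μ := by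
  rw [lintegral_lintegral_swap (by fun_prop)]
  have h : ∀ y, ∫⁻ x, f y * g (x - y) ∂μ = f y * ∫⁻ x, g x ∂μ := fun y => by
    rw [lintegral_const_mul _ (by fun_prop), lintegral_sub_right_eq_self g y]
  simp_rw [h]
  rw [lintegral_mul_const _ hf]

/-- Elliptic bilinear estimate for the null form `Q₁₂`: for `1 < r ≤ 2` and `σ > 1/r`,
`‖⟨ξ⟩^σ W(τ,ξ)‖_{L^{r'}(ℝ×ℝ²)} ≤ C ‖⟨·⟩^σ φ‖_{L^{r'}} ‖⟨·⟩^σ ψ‖_{L^{r'}}`. -/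
theorem elliptic_bilinear_estimate_Q12 (r r' σ : ℝ) (hr : 1 < r) (hr2 : r ≤ 2)
    (hrr' : 1 / r + 1 / r' = 1) (hσ : 1 / r < σ) :
    ∃ C : ℝ≥0, ∀ φ ψ : EuclideanSpace ℝ (Fin 2) → ℝ≥0∞,
      Measurable φ → Measurable ψ →
      (∫⁻ p : ℝ × EuclideanSpace ℝ (Fin 2),
          (ENNReal.ofReal ((1 + ‖p.2‖) ^ σ) * Wplus φ ψ p.1 p.2) ^ r') ^ (1 / r')
        ≤ C * (∫⁻ η, (ENNReal.ofReal ((1 + ‖η‖) ^ σ) * φ η) ^ r') ^ (1 / r')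
            * (∫⁻ η, (ENNReal.ofReal ((1 + ‖η‖) ^ σ) * ψ η) ^ r') ^ (1 / r') := by
  have hconj : r.HolderConjugate r' := Real.holderConjugate_iff.2 ⟨hr, by simpa using hrr'⟩
  have hr0 : 0 < r := hconj.pos
  have hσ0 : 0 < σ := (one_div_pos.2 hr0).trans hσ
  have hs : 1 < σ * r := by rwa [div_lt_iff₀ hr0] at hσ
  set A := (ENNReal.ofReal (2 ^ (σ * r)) * (4 * ∫⁻ x in Ioi (0 : ℝ),
    ENNReal.ofReal ((1 + x) ^ (-(σ * r))))) ^ (1 / r) with hA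
  have hAtop : A ≠ ∞ := by
    refine ENNReal.rpow_ne_top_of_nonneg (one_div_nonneg.2 hr0.le) ?_
    exact ENNReal.mul_ne_top ENNReal.ofReal_ne_top
      (ENNReal.mul_ne_top (by norm_num) (lintegral_one_add_rpow_neg_lt_top hs).ne)
  refine ⟨A.toNNReal, fun φ ψ hφ hψ => ?_⟩
  rw [ENNReal.coe_toNNReal hAtop]
  have hmain : ∫⁻ p : ℝ × EuclideanSpace ℝ (Fin 2),
      (ENNReal.ofReal ((1 + ‖p.2‖) ^ σ) * Wplus φ ψ p.1 p.2) ^ r' ≤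
      A ^ r' * ((∫⁻ η, (ENNReal.ofReal ((1 + ‖η‖) ^ σ) * φ η) ^ r') *
        ∫⁻ η, (ENNReal.ofReal ((1 + ‖η‖) ^ σ) * ψ η) ^ r') := by
    calc _ = ∫⁻ q : EuclideanSpace ℝ (Fin 2) × ℝ,
          (ENNReal.ofReal ((1 + ‖q.1‖) ^ σ) * Wplus φ ψ q.2 q.1) ^ r' :=
        ((Measure.measurePreserving_swap (μ := (volume : Measure (EuclideanSpace ℝ (Fin 2))))
          (ν := (volume : Measure ℝ))).lintegral_map_equiv _ MeasurableEquiv.prodComm)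
      _ ≤ ∫⁻ ξ : EuclideanSpace ℝ (Fin 2), ∫⁻ τ : ℝ,
          (ENNReal.ofReal ((1 + ‖ξ‖) ^ σ) * Wplus φ ψ τ ξ) ^ r' := lintegral_prod_le _
      _ ≤ ∫⁻ ξ : EuclideanSpace ℝ (Fin 2), A ^ r' *
          ∫⁻ η, (ENNReal.ofReal ((1 + ‖η‖) ^ σ) * φ η *
            (ENNReal.ofReal ((1 + ‖ξ - η‖) ^ σ) * ψ (ξ - η))) ^ r' :=
        lintegral_mono fun ξ => lintegral_Wplus_rpow_le hconj hσ0 hφ hψ ξ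
      _ = _ := by
        rw [lintegral_const_mul' _ _ (ENNReal.rpow_ne_top_of_nonneg hconj.symm.nonneg hAtop)]
        simp_rw [ENNReal.mul_rpow_of_nonneg _ _ hconj.symm.nonneg]
        congr 1
        exact lintegral_lintegral_mul_sub_eq volume (by fun_prop)
          (g := fun η => ENNReal.ofReal ((1 + ‖η‖) ^ σ) ^ r' * ψ η ^ r') (by fun_prop)
  refine (ENNReal.rpow_le_rpow hmain (one_div_nonneg.2 hconj.symm.nonneg)).trans_eq ?_
  have h0 : 0 ≤ 1 / r' := one_div_nonneg.2 hconj.symm.nonneg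
  rw [ENNReal.mul_rpow_of_nonneg _ _ h0, ENNReal.mul_rpow_of_nonneg _ _ h0, ← ENNReal.rpow_mul,
    mul_one_div_cancel hconj.symm.ne_zero, ENNReal.rpow_one, mul_assoc]
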